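/- Let d, κ, L₁, L₂ ∈ (0,∞), Γ = (L₁𝕋)×(L₂𝕋), Ω = Γ×(−d,0), Σ± as usual. Suppose u : [0,∞)×Ω̄ → ℝ³ is smooth with div u(t,·) = 0 in Ω and u₃ = 0 on Σ₊ and Σ₋, and θ : [0,∞)×Ω̄ → ℝ is a smooth bounded solution of ∂ₜθ + u·∇θ = κΔθ in Ω with ∂₃θ = 0 on Σ₊ and Σ₋. Set θ_avg = |Ω|^{−1}∫_Ω θ(0,x) dx and μ̄₀ = κπ² min{1/d², 4/L₁², 4/L₂²}. Then for all t ≥ 0, ‖θ(t,·) − θ_avg‖_{L²(Ω)} ≤ e^{−μ̄₀ t} ‖θ(0,·) − θ_avg‖_{L²(Ω)}. -/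

import Mathlib

open MeasureTheory Real Set

noncomputable section

/-- Partial derivative of `f : ℝ³ → ℝ` in the `i`-th coordinate direction. -/
def pd (i : Fin 3) (f : (Fin 3 → ℝ) → ℝ) (x : Fin 3 → ℝ) : ℝ :=
  fderiv ℝ f x (Pi.single i 1)

/-- Fundamental domain `(0,L₁)×(0,L₂)×(−d,0)` of the periodic slab `Ω = Γ×(−d,0)`. -/
def slab (L₁ L₂ d : ℝ) : Set (Fin 3 → ℝ) :=
  Set.univ.pi ![Ioo 0 L₁, Ioo 0 L₂, Ioo (-d) 0]

/-- One-dimensional Wirtinger inequality for a subcritical frequency `k`: each endpoint is either a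
zero of `g` or the centre `m` of the tangent weight. -/
lemma sq_mul_integral_sq_le_of_lt {a b k m : ℝ} (hab : a ≤ b) {g g' : ℝ → ℝ}
    (hg : ∀ x, HasDerivAt g (g' x) x) (hg' : Continuous g')
    (hk : ∀ x ∈ Icc a b, |k * (m - x)| < π / 2)
    (ha : g a = 0 ∨ m = a) (hb : g b = 0 ∨ m = b) :
    k ^ 2 * ∫ x in a..b, g x ^ 2 ≤ ∫ x in a..b, g' x ^ 2 := by
  have hgc : Continuous g := continuous_iff_continuousAt.2 fun x => (hg x).continuousAt
  have hcos : ∀ x ∈ Icc a b, cos (k * (m - x)) ≠ 0 := fun x hx =>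
    (cos_pos_of_mem_Ioo (abs_lt.1 (hk x hx))).ne'
  have htan : ContinuousOn (fun x => tan (k * (m - x))) (Icc a b) := fun x hx =>
    ((continuousAt_tan.2 (hcos x hx)).comp (f := fun x => k * (m - x))
      (by fun_prop)).continuousWithinAt
  have hder : ∀ x ∈ uIcc a b, HasDerivAt (fun x => k * tan (k * (m - x)) * g x ^ 2)
      (g' x ^ 2 - k ^ 2 * g x ^ 2 - (g' x - k * tan (k * (m - x)) * g x) ^ 2) x := by
    intro x hx
    rw [uIcc_of_le hab] at hx
    have h1 : HasDerivAt (fun x => k * (m - x)) (k * (-1)) x :=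
      ((hasDerivAt_id x).const_sub m).const_mul k
    have h2 := ((hasDerivAt_tan (hcos x hx)).comp x h1).const_mul k |>.mul ((hg x).pow 2)
    refine HasDerivAt.congr_deriv h2 ?_
    have h3 : 1 / cos (k * (m - x)) ^ 2 = 1 + tan (k * (m - x)) ^ 2 := by
      rw [← inv_one_add_tan_sq (hcos x hx)]; simp
    simp only [Function.comp, h3, Pi.pow_apply]
    push_cast
    ring
  have hc : ContinuousOn (fun x => g' x ^ 2 - k ^ 2 * g x ^ 2 -
      (g' x - k * tan (k * (m - x)) * g x) ^ 2) (uIcc a b) := by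
    rw [uIcc_of_le hab]; fun_prop
  have hc2 : ContinuousOn (fun x => (g' x - k * tan (k * (m - x)) * g x) ^ 2) (uIcc a b) := by
    rw [uIcc_of_le hab]; fun_prop
  have hft := intervalIntegral.integral_eq_sub_of_hasDerivAt hder hc.intervalIntegrable
  have i1 : IntervalIntegrable (fun x => g' x ^ 2) volume a b :=
    Continuous.intervalIntegrable (by fun_prop) _ _
  have i2 : IntervalIntegrable (fun x => k ^ 2 * g x ^ 2) volume a b :=
    Continuous.intervalIntegrable (by fun_prop) _ _
  rw [intervalIntegral.integral_sub (i1.sub i2) hc2.intervalIntegrable,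
    intervalIntegral.integral_sub i1 i2, intervalIntegral.integral_const_mul] at hft
  have hpos : 0 ≤ ∫ x in a..b, (g' x - k * tan (k * (m - x)) * g x) ^ 2 :=
    intervalIntegral.integral_nonneg hab fun x _ => sq_nonneg _
  have e1 : k * tan (k * (m - a)) * g a ^ 2 = 0 := by rcases ha with h | h <;> simp [h]
  have e2 : k * tan (k * (m - b)) * g b ^ 2 = 0 := by rcases hb with h | h <;> simp [h]
  rw [e1, e2] at hft
  linarith

/-- One-dimensional Wirtinger inequality up to the critical frequency. -/
lemma sq_mul_integral_sq_le {a b k m : ℝ} (hab : a ≤ b) {g g' : ℝ → ℝ}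
    (hg : ∀ x, HasDerivAt g (g' x) x) (hg' : Continuous g') (hk0 : 0 < k)
    (hk : ∀ x ∈ Icc a b, k * |m - x| ≤ π / 2)
    (ha : g a = 0 ∨ m = a) (hb : g b = 0 ∨ m = b) :
    k ^ 2 * ∫ x in a..b, g x ^ 2 ≤ ∫ x in a..b, g' x ^ 2 := by
  have hlim : Filter.Tendsto (fun l : ℝ => l ^ 2 * ∫ x in a..b, g x ^ 2) (nhdsWithin k (Iio k))
      (nhds (k ^ 2 * ∫ x in a..b, g x ^ 2)) :=
    (Continuous.tendsto (by fun_prop) k).mono_left nhdsWithin_le_nhds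
  refine le_of_tendsto hlim ?_
  filter_upwards [Ioo_mem_nhdsLT hk0] with l hl
  refine sq_mul_integral_sq_le_of_lt (m := m) hab hg hg' (fun x hx => ?_) ha hb
  rw [abs_mul, abs_of_pos hl.1]
  rcases eq_or_lt_of_le (abs_nonneg (m - x)) with h | h
  · rw [← h]; simp [pi_pos]
  · exact (mul_lt_mul_of_pos_right hl.2 h).trans_le (hk x hx)

lemma variance_eq {a b : ℝ} (hab : a < b) {g : ℝ → ℝ} (hg : Continuous g) (c : ℝ) :
    ∫ x in a..b, (g x - c) ^ 2 = (∫ x in a..b, g x ^ 2) - (b - a)⁻¹ * (∫ x in a..b, g x) ^ 2 +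
      (b - a) * (c - (b - a)⁻¹ * ∫ x in a..b, g x) ^ 2 := by
  have i1 : IntervalIntegrable (fun x => g x ^ 2) volume a b :=
    Continuous.intervalIntegrable (by fun_prop) _ _
  have i2 : IntervalIntegrable (fun x => 2 * c * g x) volume a b :=
    Continuous.intervalIntegrable (by fun_prop) _ _
  have h : ∫ x in a..b, (g x - c) ^ 2 =
      (∫ x in a..b, g x ^ 2) - 2 * c * (∫ x in a..b, g x) + (b - a) * c ^ 2 := by
    rw [← intervalIntegral.integral_const_mul, ← intervalIntegral.integral_sub i1 i2,
      ← smul_eq_mul (b - a), ← intervalIntegral.integral_const,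
      ← intervalIntegral.integral_add (i1.sub i2) (by simp)]
    congr 1; ext x; ring
  have hL : b - a ≠ 0 := (sub_pos.2 hab).ne'
  rw [h]
  field_simp
  ring

lemma variance_le {a b : ℝ} (hab : a < b) {g : ℝ → ℝ} (hg : Continuous g) (c : ℝ) :
    (∫ x in a..b, g x ^ 2) - (b - a)⁻¹ * (∫ x in a..b, g x) ^ 2 ≤ ∫ x in a..b, (g x - c) ^ 2 := by
  rw [variance_eq hab hg]
  have hL : 0 < b - a := sub_pos.2 hab
  exact le_add_of_nonneg_right (by positivity)

/-- Sharp Poincaré (Neumann) inequality on an interval. -/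
lemma poincare_neumann {a b : ℝ} (hab : a < b) {g g' : ℝ → ℝ}
    (hg : ∀ x, HasDerivAt g (g' x) x) (hg' : Continuous g') :
    π ^ 2 * (1 / (b - a) ^ 2) * ((∫ x in a..b, g x ^ 2) - (b - a)⁻¹ * (∫ x in a..b, g x) ^ 2) ≤
      ∫ x in a..b, g' x ^ 2 := by
  have hgc : Continuous g := continuous_iff_continuousAt.2 fun x => (hg x).continuousAt
  have hL : 0 < b - a := sub_pos.2 hab
  set p := (a + b) / 2 with hp
  have hpa : a ≤ p := by linarith
  have hpb : p ≤ b := by linarith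
  have hd : ∀ x, HasDerivAt (fun x => g x - g p) (g' x) x := fun x => (hg x).sub_const _
  have hk : ∀ r, r ≤ (b - a) / 2 → π / (b - a) * r ≤ π / 2 := fun r hr => by
    calc π / (b - a) * r ≤ π / (b - a) * ((b - a) / 2) := by gcongr
      _ = π / 2 := by field_simp
  have h1 := sq_mul_integral_sq_le (k := π / (b - a)) (m := a) hpa hd hg' (by positivity)
    (fun x hx => hk _ (by rw [abs_le]; constructor <;> linarith [hx.1, hx.2])) (Or.inr rfl)
    (Or.inl (by simp))
  have h2 := sq_mul_integral_sq_le (k := π / (b - a)) (m := b) hpb hd hg' (by positivity)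
    (fun x hx => hk _ (by rw [abs_le]; constructor <;> linarith [hx.1, hx.2]))
    (Or.inl (by simp)) (Or.inr rfl)
  have hs : ∀ f : ℝ → ℝ, Continuous f →
      (∫ x in a..b, f x) = (∫ x in a..p, f x) + ∫ x in p..b, f x := fun f hf =>
    (intervalIntegral.integral_add_adjacent_intervals (hf.intervalIntegrable _ _)
      (hf.intervalIntegrable _ _)).symm
  have hv := variance_le hab hgc (g p)
  rw [hs (fun x => (g x - g p) ^ 2) (by fun_prop)] at hv
  rw [hs (fun x => g' x ^ 2) (by fun_prop)]
  have hc : π ^ 2 * (1 / (b - a) ^ 2) = (π / (b - a)) ^ 2 := by rw [div_pow, mul_one_div]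
  rw [hc]
  have := mul_le_mul_of_nonneg_left hv (sq_nonneg (π / (b - a)))
  linarith

/-- Sharp Poincaré (Wirtinger) inequality for periodic functions. -/
lemma poincare_periodic {L : ℝ} (hL : 0 < L) {g g' : ℝ → ℝ}
    (hg : ∀ x, HasDerivAt g (g' x) x) (hg' : Continuous g') (hper : Function.Periodic g L) :
    π ^ 2 * (4 / L ^ 2) * ((∫ x in 0..L, g x ^ 2) - L⁻¹ * (∫ x in 0..L, g x) ^ 2) ≤
      ∫ x in 0..L, g' x ^ 2 := by
  have hgc : Continuous g := continuous_iff_continuousAt.2 fun x => (hg x).continuousAt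
  have hper' : Function.Periodic g' L := fun x => by
    have h := (hg (x + L)).comp_add_const x L
    have e : (fun y => g (y + L)) = g := funext hper
    rw [e] at h
    exact h.unique (hg x)
  obtain ⟨p, hp⟩ : ∃ p, g (p + L / 2) = g p := by
    have hc : ContinuousOn (fun x => g (x + L / 2) - g x) (uIcc 0 (L / 2)) := by fun_prop
    have h0 : (0 : ℝ) ∈ uIcc (g (0 + L / 2) - g 0) (g (L / 2 + L / 2) - g (L / 2)) := by
      have : g (L / 2 + L / 2) = g 0 := by rw [add_halves]; simpa using hper 0
      rw [this, zero_add, mem_uIcc]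
      rcases le_total (g 0) (g (L / 2)) with h | h
      · right; constructor <;> linarith
      · left; constructor <;> linarith
    obtain ⟨p, -, hp⟩ := intermediate_value_uIcc hc h0
    exact ⟨p, sub_eq_zero.1 hp⟩
  have hd : ∀ x, HasDerivAt (fun x => g x - g p) (g' x) x := fun x => (hg x).sub_const _
  have hk : ∀ r, r ≤ L / 4 → 2 * π / L * r ≤ π / 2 := fun r hr => by
    calc 2 * π / L * r ≤ 2 * π / L * (L / 4) := by gcongr
      _ = π / 2 := by field_simp; ring
  have h1 := sq_mul_integral_sq_le (a := p) (b := p + L / 2) (k := 2 * π / L) (m := p + L / 4)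
    (by linarith) hd hg' (by positivity)
    (fun x hx => hk _ (by rw [abs_le]; constructor <;> linarith [hx.1, hx.2]))
    (Or.inl (by simp)) (Or.inl (by simp [hp]))
  have h2 := sq_mul_integral_sq_le (a := p + L / 2) (b := p + L) (k := 2 * π / L)
    (m := p + 3 * L / 4) (by linarith) hd hg' (by positivity)
    (fun x hx => hk _ (by rw [abs_le]; constructor <;> linarith [hx.1, hx.2]))
    (Or.inl (by simp [hp])) (Or.inl (by simp [hper p]))
  have hs : ∀ f : ℝ → ℝ, Continuous f → Function.Periodic f L →
      (∫ x in 0..L, f x) = (∫ x in p..p + L / 2, f x) + ∫ x in p + L / 2..p + L, f x :=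
    fun f hf hfp => by
      rw [intervalIntegral.integral_add_adjacent_intervals (hf.intervalIntegrable _ _)
        (hf.intervalIntegrable _ _), ← hfp.intervalIntegral_add_eq 0 p, zero_add]
  have hv := variance_le hL hgc (g p)
  rw [hs (fun x => (g x - g p) ^ 2) (by fun_prop) (fun x => by simp [hper x])] at hv
  rw [hs (fun x => g' x ^ 2) (by fun_prop) (fun x => by simp [hper' x])]
  have hc : π ^ 2 * (4 / L ^ 2) = (2 * π / L) ^ 2 := by ring
  rw [hc]
  rw [sub_zero] at hv
  have := mul_le_mul_of_nonneg_left hv (sq_nonneg (2 * π / L))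
  linarith

/-- Differentiation under the integral over a relatively compact set. -/
lemma hasDerivAt_setIntegral_of_continuous {X : Type*} [TopologicalSpace X] [MeasurableSpace X]
    [OpensMeasurableSpace X] {μ : Measure X} [IsFiniteMeasureOnCompacts μ] {s K : Set X}
    (hK : IsCompact K) (hsK : s ⊆ K) (hs : MeasurableSet s) {f f' : ℝ → X → ℝ}
    (hf : ∀ t, Continuous (f t)) (hf' : Continuous fun q : ℝ × X => f' q.1 q.2)
    (hd : ∀ t x, HasDerivAt (fun t => f t x) (f' t x) t) (t : ℝ) :
    HasDerivAt (fun t => ∫ x in s, f t x ∂μ) (∫ x in s, f' t x ∂μ) t := by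
  have hfin : μ s ≠ ⊤ := ((measure_mono hsK).trans_lt hK.measure_lt_top).ne
  have hgi : ∀ g : X → ℝ, Continuous g → IntegrableOn g s μ := fun g hg => by
    obtain ⟨C, hC⟩ := hK.exists_bound_of_continuousOn hg.continuousOn
    exact Measure.integrableOn_of_bounded (M := C) hfin hg.aestronglyMeasurable
      ((ae_restrict_iff' hs).2 (.of_forall fun x hx => hC x (hsK hx)))
  obtain ⟨C, hC⟩ := ((isCompact_Icc (a := t - 1) (b := t + 1)).prod hK).exists_bound_of_continuousOn
    hf'.continuousOn
  refine (hasDerivAt_integral_of_dominated_loc_of_deriv_le (bound := fun _ => C)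
    (Icc_mem_nhds (by linarith : t - 1 < t) (by linarith : t < t + 1))
    (.of_forall fun r => (hf r).aestronglyMeasurable) (hgi _ (hf t))
    (Continuous.aestronglyMeasurable (by fun_prop)) ?_ (integrableOn_const hfin) ?_).2
  · exact (ae_restrict_iff' hs).2 (.of_forall fun x hx r hr => hC (r, x) ⟨hr, hsK hx⟩)
  · exact .of_forall fun x r _ => hd r x

lemma hasDerivAt_intervalIntegral_of_continuous {a b : ℝ} (hab : a ≤ b) {f f' : ℝ → ℝ → ℝ}
    (hf : ∀ t, Continuous (f t)) (hf' : Continuous fun q : ℝ × ℝ => f' q.1 q.2)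
    (hd : ∀ t x, HasDerivAt (fun t => f t x) (f' t x) t) (t : ℝ) :
    HasDerivAt (fun t => ∫ x in a..b, f t x) (∫ x in a..b, f' t x) t := by
  simp only [intervalIntegral.integral_of_le hab]
  exact hasDerivAt_setIntegral_of_continuous isCompact_Icc Ioc_subset_Icc_self measurableSet_Ioc
    hf hf' hd t

lemma measurableSet_slab (L₁ L₂ d : ℝ) : MeasurableSet (slab L₁ L₂ d) := by
  refine MeasurableSet.univ_pi fun i => ?_
  fin_cases i <;> exact measurableSet_Ioo

lemma slab_subset_Icc (L₁ L₂ d : ℝ) : slab L₁ L₂ d ⊆ Icc ![0, 0, -d] ![L₁, L₂, 0] := by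
  intro x hx
  simp only [slab, mem_univ_pi, Fin.forall_fin_succ] at hx
  simp at hx
  simp [Pi.le_def, Fin.forall_fin_succ]
  grind

lemma integrableOn_slab (L₁ L₂ d : ℝ) {f : (Fin 3 → ℝ) → ℝ} (hf : Continuous f) :
    IntegrableOn f (slab L₁ L₂ d) :=
  (hf.continuousOn.integrableOn_compact isCompact_Icc).mono_set (slab_subset_Icc L₁ L₂ d)

/-- Fubini on the slab. -/
lemma setIntegral_slab {L₁ L₂ d : ℝ} (hL₁ : 0 ≤ L₁) (hL₂ : 0 ≤ L₂) (hd : 0 ≤ d)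
    {f : (Fin 3 → ℝ) → ℝ} (hf : Continuous f) :
    ∫ x in slab L₁ L₂ d, f x = ∫ a in 0..L₁, ∫ b in 0..L₂, ∫ c in -d..0, f ![a, b, c] := by
  have e1 := (volume_preserving_piFinSuccAbove (fun _ : Fin 3 => ℝ) 0).symm
  have e2 := (volume_preserving_finTwoArrow ℝ).symm
  have e3 := (MeasurePreserving.id (volume : Measure ℝ)).prod e2
  have e := e1.comp e3
  have hmap : ∀ a b c : ℝ, ((MeasurableEquiv.piFinSuccAbove (fun _ : Fin 3 => ℝ) 0).symm ∘
      Prod.map id (MeasurableEquiv.finTwoArrow (α := ℝ)).symm) (a, b, c) = ![a, b, c] := by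
    intro a b c
    ext i
    fin_cases i <;> rfl
  have hpre : ((MeasurableEquiv.piFinSuccAbove (fun _ : Fin 3 => ℝ) 0).symm ∘
      Prod.map id (MeasurableEquiv.finTwoArrow (α := ℝ)).symm) ⁻¹' slab L₁ L₂ d =
      Ioo 0 L₁ ×ˢ (Ioo 0 L₂ ×ˢ Ioo (-d) 0) := by
    ext ⟨a, b, c⟩
    rw [mem_preimage, hmap]
    simp [slab, Fin.forall_fin_succ]
  have hemb : MeasurableEmbedding ((MeasurableEquiv.piFinSuccAbove (fun _ : Fin 3 => ℝ) 0).symm ∘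
      Prod.map id (MeasurableEquiv.finTwoArrow (α := ℝ)).symm) :=
    (MeasurableEquiv.measurableEmbedding _).comp
      (MeasurableEmbedding.id.prodMap (MeasurableEquiv.measurableEmbedding _))
  rw [← e.setIntegral_preimage_emb hemb, hpre]
  have hc : Continuous fun q : ℝ × ℝ × ℝ => f ![q.1, q.2.1, q.2.2] := by fun_prop
  have hfe : ∀ q : ℝ × ℝ × ℝ, f (((MeasurableEquiv.piFinSuccAbove (fun _ : Fin 3 => ℝ) 0).symm ∘
      Prod.map id (MeasurableEquiv.finTwoArrow (α := ℝ)).symm) q) = f ![q.1, q.2.1, q.2.2] :=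
    fun q => by rw [← hmap]
  simp only [hfe]
  have hi : ∀ a b : ℝ, a ≤ b → ∀ g : ℝ → ℝ, ∫ x in Ioo a b, g x = ∫ x in a..b, g x :=
    fun a b h g => by rw [intervalIntegral.integral_of_le h, integral_Ioc_eq_integral_Ioo]
  rw [Measure.volume_eq_prod, setIntegral_prod _ ((hc.continuousOn.integrableOn_compact
    (isCompact_Icc.prod (isCompact_Icc.prod isCompact_Icc))).mono_set
    (prod_mono Ioo_subset_Icc_self (prod_mono Ioo_subset_Icc_self Ioo_subset_Icc_self))),
    hi _ _ hL₁]
  congr 1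
  ext a
  rw [setIntegral_prod _ (((by fun_prop : Continuous fun q : ℝ × ℝ =>
    f ![a, q.1, q.2]).continuousOn.integrableOn_compact
    (isCompact_Icc.prod isCompact_Icc)).mono_set
    (prod_mono Ioo_subset_Icc_self Ioo_subset_Icc_self)), hi _ _ hL₂]
  congr 1
  ext b
  rw [hi _ _ (by linarith)]

lemma continuous_pd {f : (Fin 3 → ℝ) → ℝ} (hf : ContDiff ℝ 1 f) (i : Fin 3) :
    Continuous (pd i f) :=
  (hf.continuous_fderiv one_ne_zero).clm_apply continuous_const

lemma hasDerivAt_pd_zero {f : (Fin 3 → ℝ) → ℝ} (hf : ContDiff ℝ 1 f) (a b c : ℝ) :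
    HasDerivAt (fun s => f ![s, b, c]) (pd 0 f ![a, b, c]) a := by
  have h : HasDerivAt (fun s : ℝ => ![s, b, c]) (Pi.single 0 1) a := by
    rw [hasDerivAt_pi]
    intro i
    fin_cases i <;> simp [hasDerivAt_id', hasDerivAt_const]
  exact (hf.differentiable one_ne_zero _).hasFDerivAt.comp_hasDerivAt a h

lemma hasDerivAt_pd_one {f : (Fin 3 → ℝ) → ℝ} (hf : ContDiff ℝ 1 f) (a b c : ℝ) :
    HasDerivAt (fun s => f ![a, s, c]) (pd 1 f ![a, b, c]) b := by
  have h : HasDerivAt (fun s : ℝ => ![a, s, c]) (Pi.single 1 1) b := by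
    rw [hasDerivAt_pi]
    intro i
    fin_cases i <;> simp [hasDerivAt_id', hasDerivAt_const]
  exact (hf.differentiable one_ne_zero _).hasFDerivAt.comp_hasDerivAt b h

lemma hasDerivAt_pd_two {f : (Fin 3 → ℝ) → ℝ} (hf : ContDiff ℝ 1 f) (a b c : ℝ) :
    HasDerivAt (fun s => f ![a, b, s]) (pd 2 f ![a, b, c]) c := by
  have h : HasDerivAt (fun s : ℝ => ![a, b, s]) (Pi.single 2 1) c := by
    rw [hasDerivAt_pi]
    intro i
    fin_cases i <;> simp [hasDerivAt_id', hasDerivAt_const]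
  exact (hf.differentiable one_ne_zero _).hasFDerivAt.comp_hasDerivAt c h

/-- Divergence theorem on the periodic slab for fields tangent to the boundary. -/
lemma setIntegral_slab_divergence {L₁ L₂ d : ℝ} (hL₁ : 0 ≤ L₁) (hL₂ : 0 ≤ L₂) (hd : 0 ≤ d)
    {G : Fin 3 → (Fin 3 → ℝ) → ℝ} (hG : ∀ i, ContDiff ℝ 1 (G i))
    (h0 : ∀ x, G 0 (x + Pi.single 0 L₁) = G 0 x) (h1 : ∀ x, G 1 (x + Pi.single 1 L₂) = G 1 x)
    (htop : ∀ a b, G 2 ![a, b, 0] = 0) (hbot : ∀ a b, G 2 ![a, b, -d] = 0) :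
    ∫ x in slab L₁ L₂ d, ∑ i, pd i (G i) x = 0 := by
  have hGc := fun i => (hG i).continuous
  have hpc := fun i => continuous_pd (hG i) i
  rw [integral_finsetSum _ fun i _ => integrableOn_slab L₁ L₂ d (hpc i)]
  rw [Fin.sum_univ_three, setIntegral_slab hL₁ hL₂ hd (hpc 0), setIntegral_slab hL₁ hL₂ hd (hpc 1),
    setIntegral_slab hL₁ hL₂ hd (hpc 2)]
  have hd' : -d ≤ 0 := by linarith
  have e0 : ∫ a in 0..L₁, ∫ b in 0..L₂, ∫ c in -d..0, pd 0 (G 0) ![a, b, c] = 0 := by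
    have hD : ∀ a, HasDerivAt (fun a => ∫ b in 0..L₂, ∫ c in -d..0, G 0 ![a, b, c])
        (∫ b in 0..L₂, ∫ c in -d..0, pd 0 (G 0) ![a, b, c]) a := fun a =>
      hasDerivAt_intervalIntegral_of_continuous hL₂ (fun t => by fun_prop) (by fun_prop)
        (fun t b => hasDerivAt_intervalIntegral_of_continuous hd' (fun t => by fun_prop)
          (by fun_prop) (fun t c => hasDerivAt_pd_zero (hG 0) t b c) t) a
    rw [intervalIntegral.integral_eq_sub_of_hasDerivAt (fun a _ => hD a)
      (Continuous.intervalIntegrable (by fun_prop) _ _), sub_eq_zero]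
    congr 1; ext b; congr 1; ext c
    rw [← h0 ![0, b, c]]
    congr 1
    ext i
    fin_cases i <;> simp
  have e1 : ∀ a, ∫ b in 0..L₂, ∫ c in -d..0, pd 1 (G 1) ![a, b, c] = 0 := fun a => by
    have hD : ∀ b, HasDerivAt (fun b => ∫ c in -d..0, G 1 ![a, b, c])
        (∫ c in -d..0, pd 1 (G 1) ![a, b, c]) b := fun b =>
      hasDerivAt_intervalIntegral_of_continuous hd' (fun t => by fun_prop)
          (by fun_prop) (fun t c => hasDerivAt_pd_one (hG 1) a t c) b
    rw [intervalIntegral.integral_eq_sub_of_hasDerivAt (fun a _ => hD a)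
      (Continuous.intervalIntegrable (by fun_prop) _ _), sub_eq_zero]
    congr 1; ext c
    rw [← h1 ![a, 0, c]]
    congr 1
    ext i
    fin_cases i <;> simp
  have e2 : ∀ a b, ∫ c in -d..0, pd 2 (G 2) ![a, b, c] = 0 := fun a b => by
    rw [intervalIntegral.integral_eq_sub_of_hasDerivAt (fun c _ => hasDerivAt_pd_two (hG 2) a b c)
      (Continuous.intervalIntegrable (by fun_prop) _ _), htop, hbot, sub_zero]
  simp [e0, e1, e2]

lemma sq_intervalIntegral_le {a b : ℝ} (hab : a < b) {g : ℝ → ℝ} (hg : Continuous g) :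
    (∫ x in a..b, g x) ^ 2 ≤ (b - a) * ∫ x in a..b, g x ^ 2 := by
  have h := variance_eq hab hg ((b - a)⁻¹ * ∫ x in a..b, g x)
  have hL : 0 < b - a := sub_pos.2 hab
  have h0 : 0 ≤ ∫ x in a..b, (g x - (b - a)⁻¹ * ∫ x in a..b, g x) ^ 2 :=
    intervalIntegral.integral_nonneg hab.le fun x _ => sq_nonneg _
  rw [h, sub_self] at h0
  have := mul_nonneg hL.le h0
  field_simp at this
  linarith

lemma mul_variance_mono {a b l l' C : ℝ} (hab : a < b) {g : ℝ → ℝ} (hg : Continuous g)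
    (hl : l ≤ l')
    (h : l' * ((∫ x in a..b, g x ^ 2) - (b - a)⁻¹ * (∫ x in a..b, g x) ^ 2) ≤ C) :
    l * ((∫ x in a..b, g x ^ 2) - (b - a)⁻¹ * (∫ x in a..b, g x) ^ 2) ≤ C := by
  refine le_trans (mul_le_mul_of_nonneg_right hl ?_) h
  have hL : 0 < b - a := sub_pos.2 hab
  rw [sub_nonneg, inv_mul_le_iff₀ hL]
  exact sq_intervalIntegral_le hab hg

/-- Sharp Neumann Poincaré inequality on the periodic slab. -/
lemma poincare_slab {L₁ L₂ d l : ℝ} (hL₁ : 0 < L₁) (hL₂ : 0 < L₂) (hd : 0 < d)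
    (hl : l = π ^ 2 * min (1 / d ^ 2) (min (4 / L₁ ^ 2) (4 / L₂ ^ 2)))
    {f : (Fin 3 → ℝ) → ℝ} (hf : ContDiff ℝ 1 f)
    (h0 : ∀ x, f (x + Pi.single 0 L₁) = f x) (h1 : ∀ x, f (x + Pi.single 1 L₂) = f x)
    (hmean : ∫ x in slab L₁ L₂ d, f x = 0) :
    l * ∫ x in slab L₁ L₂ d, f x ^ 2 ≤ ∫ x in slab L₁ L₂ d, ∑ i, pd i f x ^ 2 := by
  have hfc := hf.continuous
  have hpc := continuous_pd hf
  have hd' : -d < 0 := by linarith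
  have l0 : l ≤ π ^ 2 * (4 / L₁ ^ 2) := by
    rw [hl]; gcongr; exact (min_le_right _ _).trans (min_le_left _ _)
  have l1 : l ≤ π ^ 2 * (4 / L₂ ^ 2) := by
    rw [hl]; gcongr; exact (min_le_right _ _).trans (min_le_right _ _)
  have l2 : l ≤ π ^ 2 * (1 / (0 - -d) ^ 2) := by
    rw [hl, zero_sub, neg_neg]; gcongr; exact min_le_left _ _
  rw [integral_finsetSum _ fun i _ => integrableOn_slab L₁ L₂ d (by fun_prop)]
  rw [Fin.sum_univ_three, setIntegral_slab hL₁.le hL₂.le hd.le (by fun_prop),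
    setIntegral_slab hL₁.le hL₂.le hd.le (by fun_prop),
    setIntegral_slab hL₁.le hL₂.le hd.le (by fun_prop),
    setIntegral_slab hL₁.le hL₂.le hd.le (by fun_prop)]
  rw [setIntegral_slab hL₁.le hL₂.le hd.le hfc] at hmean
  have hmono : ∀ L : ℝ, 0 < L → ∀ F G : ℝ → ℝ, Continuous F → Continuous G →
      (∀ x, F x ≤ G x) → ∫ x in 0..L, F x ≤ ∫ x in 0..L, G x := fun L hL F G hF hG h =>
    intervalIntegral.integral_mono hL.le (hF.intervalIntegrable _ _) (hG.intervalIntegrable _ _) h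
  have hcomb : ∀ (L r : ℝ) (F G : ℝ → ℝ), Continuous F → Continuous G →
      ∫ x in 0..L, l * (F x - r * G x) = l * ((∫ x in 0..L, F x) - r * ∫ x in 0..L, G x) :=
    fun L r F G hF hG => by
      rw [intervalIntegral.integral_const_mul, intervalIntegral.integral_sub
        (hF.intervalIntegrable _ _) ((hG.intervalIntegrable _ _).const_mul r),
        intervalIntegral.integral_const_mul]
  set G : ℝ → ℝ → ℝ := fun a b => ∫ c in -d..0, f ![a, b, c] with hG
  set H : ℝ → ℝ := fun a => ∫ b in 0..L₂, G a b with hH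
  have hGc : Continuous fun q : ℝ × ℝ => G q.1 q.2 := by fun_prop
  have hHc : Continuous H := by fun_prop
  have i2 : l * ((∫ a in 0..L₁, ∫ b in 0..L₂, ∫ c in -d..0, f ![a, b, c] ^ 2) -
      d⁻¹ * ∫ a in 0..L₁, ∫ b in 0..L₂, G a b ^ 2) ≤
      ∫ a in 0..L₁, ∫ b in 0..L₂, ∫ c in -d..0, pd 2 f ![a, b, c] ^ 2 := by
    rw [← hcomb _ _ _ _ (by fun_prop) (by fun_prop)]
    refine hmono _ hL₁ _ _ (by fun_prop) (by fun_prop) fun a => ?_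
    rw [← hcomb _ _ _ _ (by fun_prop) (by fun_prop)]
    refine hmono _ hL₂ _ _ (by fun_prop) (by fun_prop) fun b => ?_
    have := mul_variance_mono hd' (g := fun c => f ![a, b, c]) (by fun_prop) l2
      (poincare_neumann hd' (hasDerivAt_pd_two hf a b) (by fun_prop))
    simpa using this
  have i1 : l * ((∫ a in 0..L₁, ∫ b in 0..L₂, G a b ^ 2) - L₂⁻¹ * ∫ a in 0..L₁, H a ^ 2) ≤
      d * ∫ a in 0..L₁, ∫ b in 0..L₂, ∫ c in -d..0, pd 1 f ![a, b, c] ^ 2 := by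
    rw [← hcomb _ _ _ _ (by fun_prop) (by fun_prop), ← intervalIntegral.integral_const_mul]
    refine hmono _ hL₁ _ _ (by fun_prop) (by fun_prop) fun a => ?_
    have hD : ∀ b, HasDerivAt (G a) (∫ c in -d..0, pd 1 f ![a, b, c]) b := fun b =>
      hasDerivAt_intervalIntegral_of_continuous hd'.le (fun t => by fun_prop)
          (by fun_prop) (fun t c => hasDerivAt_pd_one hf a t c) b
    have hP : Function.Periodic (G a) L₂ := fun b => by
      simp only [hG]
      congr 1; ext c
      rw [← h1 ![a, b, c]]
      congr 1
      ext i
      fin_cases i <;> simp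
    have hw := poincare_periodic hL₂ hD (by fun_prop) hP
    nth_rw 3 [← sub_zero L₂] at hw
    have := mul_variance_mono hL₂ (by fun_prop) l1 hw
    rw [sub_zero] at this
    refine this.trans ?_
    rw [← intervalIntegral.integral_const_mul]
    refine hmono _ hL₂ _ _ (by fun_prop) (by fun_prop) fun b => ?_
    simpa using sq_intervalIntegral_le hd' (g := fun c => pd 1 f ![a, b, c]) (by fun_prop)
  have i0 : l * ∫ a in 0..L₁, H a ^ 2 ≤
      L₂ * (d * ∫ a in 0..L₁, ∫ b in 0..L₂, ∫ c in -d..0, pd 0 f ![a, b, c] ^ 2) := by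
    have hD : ∀ a, HasDerivAt H (∫ b in 0..L₂, ∫ c in -d..0, pd 0 f ![a, b, c]) a := fun a =>
      hasDerivAt_intervalIntegral_of_continuous hL₂.le (fun t => by fun_prop) (by fun_prop)
        (fun t b => hasDerivAt_intervalIntegral_of_continuous hd'.le (fun t => by fun_prop)
          (by fun_prop) (fun t c => hasDerivAt_pd_zero hf t b c) t) a
    have hP : Function.Periodic H L₁ := fun a => by
      simp only [hH, hG]
      congr 1; ext b; congr 1; ext c
      rw [← h0 ![a, b, c]]
      congr 1
      ext i
      fin_cases i <;> simp
    have hw := poincare_periodic hL₁ hD (by fun_prop) hP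
    nth_rw 3 [← sub_zero L₁] at hw
    have := mul_variance_mono hL₁ hHc l0 hw
    rw [hmean] at this
    simp only [ne_eq, OfNat.ofNat_ne_zero, not_false_eq_true, zero_pow, mul_zero, sub_zero] at this
    refine this.trans ?_
    rw [← intervalIntegral.integral_const_mul, ← intervalIntegral.integral_const_mul]
    refine hmono _ hL₁ _ _ (by fun_prop) (by fun_prop) fun a => ?_
    have hs := sq_intervalIntegral_le hL₂ (g := fun b => ∫ c in -d..0, pd 0 f ![a, b, c])
      (by fun_prop)
    rw [sub_zero] at hs
    refine hs.trans ?_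
    gcongr
    rw [← intervalIntegral.integral_const_mul]
    refine hmono _ hL₂ _ _ (by fun_prop) (by fun_prop) fun b => ?_
    simpa using sq_intervalIntegral_le hd' (g := fun c => pd 0 f ![a, b, c]) (by fun_prop)
  have j1 := mul_le_mul_of_nonneg_left i1 (inv_nonneg.2 hd.le)
  have j0 := mul_le_mul_of_nonneg_left i0 (mul_nonneg (inv_nonneg.2 hd.le) (inv_nonneg.2 hL₂.le))
  rw [inv_mul_cancel_left₀ hd.ne'] at j1
  have e : d⁻¹ * L₂⁻¹ * (L₂ * (d * ∫ a in 0..L₁, ∫ b in 0..L₂, ∫ c in -d..0,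
      pd 0 f ![a, b, c] ^ 2)) = ∫ a in 0..L₁, ∫ b in 0..L₂, ∫ c in -d..0,
      pd 0 f ![a, b, c] ^ 2 := by
    field_simp
  rw [e] at j0
  linarith

lemma pd_mul {f g : (Fin 3 → ℝ) → ℝ} {x : Fin 3 → ℝ} (hf : DifferentiableAt ℝ f x)
    (hg : DifferentiableAt ℝ g x) (i : Fin 3) :
    pd i (fun y => f y * g y) x = f x * pd i g x + g x * pd i f x := by
  simp only [pd, fderiv_fun_mul hf hg]
  simp

lemma pd_sub {f g : (Fin 3 → ℝ) → ℝ} {x : Fin 3 → ℝ} (hf : DifferentiableAt ℝ f x)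
    (hg : DifferentiableAt ℝ g x) (i : Fin 3) :
    pd i (fun y => f y - g y) x = pd i f x - pd i g x := by
  simp only [pd, fderiv_fun_sub hf hg]
  simp

lemma pd_const_mul {f : (Fin 3 → ℝ) → ℝ} {x : Fin 3 → ℝ} (hf : DifferentiableAt ℝ f x) (r : ℝ)
    (i : Fin 3) : pd i (fun y => r * f y) x = r * pd i f x := by
  simp only [pd, fderiv_const_mul hf]
  simp

lemma pd_sub_const (f : (Fin 3 → ℝ) → ℝ) (c : ℝ) (i : Fin 3) :
    pd i (fun y => f y - c) = pd i f := by
  ext x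
  simp only [pd, fderiv_sub_const]

lemma pd_add_period {f : (Fin 3 → ℝ) → ℝ} {e : Fin 3 → ℝ} (h : ∀ x, f (x + e) = f x) (i : Fin 3)
    (x : Fin 3 → ℝ) : pd i f (x + e) = pd i f x := by
  unfold pd
  rw [← fderiv_comp_add_right, funext h]

lemma contDiff_pd {f : (Fin 3 → ℝ) → ℝ} (hf : ContDiff ℝ (⊤ : ℕ∞) f) (i : Fin 3) :
    ContDiff ℝ (⊤ : ℕ∞) (pd i f) :=
  (hf.fderiv_right (by simp)).clm_apply contDiff_const

section Static

variable {d κ L₁ L₂ : ℝ} {v : (Fin 3 → ℝ) → (Fin 3 → ℝ)} {w : (Fin 3 → ℝ) → ℝ}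

/-- The advection-diffusion operator has zero mean over the slab. -/
lemma setIntegral_advection_diffusion (hd : 0 ≤ d) (hL₁ : 0 ≤ L₁) (hL₂ : 0 ≤ L₂)
    (hv : ContDiff ℝ (⊤ : ℕ∞) v) (hw : ContDiff ℝ (⊤ : ℕ∞) w)
    (hv1 : ∀ x, v (x + Pi.single 0 L₁) = v x) (hv2 : ∀ x, v (x + Pi.single 1 L₂) = v x)
    (hw1 : ∀ x, w (x + Pi.single 0 L₁) = w x) (hw2 : ∀ x, w (x + Pi.single 1 L₂) = w x)
    (hdiv : ∀ x ∈ slab L₁ L₂ d, (∑ i, pd i (fun y => v y i) x) = 0)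
    (hvt : ∀ a b, v ![a, b, 0] 2 = 0) (hvb : ∀ a b, v ![a, b, -d] 2 = 0)
    (hwt : ∀ a b, pd 2 w ![a, b, 0] = 0) (hwb : ∀ a b, pd 2 w ![a, b, -d] = 0) :
    ∫ x in slab L₁ L₂ d, (κ * ∑ i, pd i (pd i w) x - ∑ i, v x i * pd i w x) = 0 := by
  have hp := contDiff_pd hw
  have hvi : ∀ i, ContDiff ℝ (⊤ : ℕ∞) fun y => v y i := fun i => by fun_prop
  have hG : ∀ i, ContDiff ℝ (⊤ : ℕ∞) fun y => κ * pd i w y - v y i * w y := fun i => by fun_prop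
  have hdw : Differentiable ℝ w := hw.differentiable (by simp)
  have hdp : ∀ i, Differentiable ℝ (pd i w) := fun i => (hp i).differentiable (by simp)
  have hdv : ∀ i, Differentiable ℝ fun y => v y i := fun i => (hvi i).differentiable (by simp)
  rw [← setIntegral_slab_divergence hL₁ hL₂ hd
    (G := fun i y => κ * pd i w y - v y i * w y) (fun i => (hG i).of_le (by simp))
    (fun x => by rw [pd_add_period hw1, hv1, hw1]) (fun x => by rw [pd_add_period hw2, hv2, hw2])
    (fun a b => by rw [hwt, hvt]; ring) (fun a b => by rw [hwb, hvb]; ring)]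
  refine setIntegral_congr_fun (measurableSet_slab L₁ L₂ d) fun x hx => ?_
  have hx' := hdiv x hx
  have e : ∀ i, pd i (fun y => κ * pd i w y - v y i * w y) x =
      κ * pd i (pd i w) x - (v x i * pd i w x + w x * pd i (fun y => v y i) x) := fun i => by
    rw [pd_sub ((hdp i x).const_mul κ) ((hdv i x).fun_mul (hdw x)), pd_const_mul (hdp i x),
      pd_mul (hdv i x) (hdw x)]
  simp only [e, Finset.sum_sub_distrib, Finset.sum_add_distrib, ← Finset.mul_sum, hx']
  ring

/-- Energy identity for the advection-diffusion operator. -/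
lemma setIntegral_energy (hd : 0 ≤ d) (hL₁ : 0 ≤ L₁) (hL₂ : 0 ≤ L₂)
    (hv : ContDiff ℝ (⊤ : ℕ∞) v) (hw : ContDiff ℝ (⊤ : ℕ∞) w)
    (hv1 : ∀ x, v (x + Pi.single 0 L₁) = v x) (hv2 : ∀ x, v (x + Pi.single 1 L₂) = v x)
    (hw1 : ∀ x, w (x + Pi.single 0 L₁) = w x) (hw2 : ∀ x, w (x + Pi.single 1 L₂) = w x)
    (hdiv : ∀ x ∈ slab L₁ L₂ d, (∑ i, pd i (fun y => v y i) x) = 0)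
    (hvt : ∀ a b, v ![a, b, 0] 2 = 0) (hvb : ∀ a b, v ![a, b, -d] 2 = 0)
    (hwt : ∀ a b, pd 2 w ![a, b, 0] = 0) (hwb : ∀ a b, pd 2 w ![a, b, -d] = 0) :
    ∫ x in slab L₁ L₂ d, 2 * w x * (κ * ∑ i, pd i (pd i w) x - ∑ i, v x i * pd i w x) =
      -(2 * κ) * ∫ x in slab L₁ L₂ d, ∑ i, pd i w x ^ 2 := by
  have hp := contDiff_pd hw
  have hpp := fun i => contDiff_pd (hp i) i
  have hvi : ∀ i, ContDiff ℝ (⊤ : ℕ∞) fun y => v y i := fun i => by fun_prop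
  have hG : ∀ i, ContDiff ℝ (⊤ : ℕ∞) fun y => (2 * κ) * (w y * pd i w y) - v y i * (w y * w y) :=
    fun i => by fun_prop
  have hdw : Differentiable ℝ w := hw.differentiable (by simp)
  have hdp : ∀ i, Differentiable ℝ (pd i w) := fun i => (hp i).differentiable (by simp)
  have hdv : ∀ i, Differentiable ℝ fun y => v y i := fun i => (hvi i).differentiable (by simp)
  have hpc := fun i => (hp i).continuous
  have hppc := fun i => (hpp i).continuous
  have hvc := fun i => (hvi i).continuous
  have hwc := hw.continuous
  rw [← integral_const_mul, ← sub_eq_zero, ← integral_sub (integrableOn_slab _ _ _ (by fun_prop))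
    (integrableOn_slab _ _ _ (by fun_prop)), ← setIntegral_slab_divergence hL₁ hL₂ hd
    (G := fun i y => (2 * κ) * (w y * pd i w y) - v y i * (w y * w y))
    (fun i => (hG i).of_le (by simp))
    (fun x => by rw [pd_add_period hw1, hv1, hw1]) (fun x => by rw [pd_add_period hw2, hv2, hw2])
    (fun a b => by rw [hwt, hvt]; ring) (fun a b => by rw [hwb, hvb]; ring)]
  refine setIntegral_congr_fun (measurableSet_slab L₁ L₂ d) fun x hx => ?_
  have hx' := hdiv x hx
  have e : ∀ i, pd i (fun y => (2 * κ) * (w y * pd i w y) - v y i * (w y * w y)) x =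
      (2 * κ) * (w x * pd i (pd i w) x + pd i w x * pd i w x) -
        (v x i * (w x * pd i w x + w x * pd i w x) + w x * w x * pd i (fun y => v y i) x) :=
    fun i => by
      rw [pd_sub (((hdw x).fun_mul (hdp i x)).const_mul _) ((hdv i x).fun_mul ((hdw x).fun_mul (hdw x))),
        pd_const_mul ((hdw x).fun_mul (hdp i x)), pd_mul (hdw x) (hdp i x),
        pd_mul (hdv i x) ((hdw x).fun_mul (hdw x)), pd_mul (hdw x) (hdw x)]
  simp only [e]
  simp only [Fin.sum_univ_three] at hx' ⊢
  linear_combination w x * w x * hx'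

end Static

/-- **Exponential equilibration of the insulating passive scalar on a rigid periodic
slab.**  If `θ` is a smooth bounded solution of `∂ₜθ + u·∇θ = κΔθ` in `Ω` with
`∂₃θ = 0` on `Σ₊` and `Σ₋`, `u` divergence-free and tangent to the boundary, then with
`θ_avg = |Ω|⁻¹ ∫_Ω θ(0)` and `μ̄₀ = κπ² min{1/d², 4/L₁², 4/L₂²}`, for all `t ≥ 0`,
`‖θ(t) − θ_avg‖_{L²(Ω)} ≤ e^{−μ̄₀ t} ‖θ(0) − θ_avg‖_{L²(Ω)}`. -/
theorem rigid_neumann_decay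
    (d κ L₁ L₂ : ℝ)
    (hd : 0 < d) (hκ : 0 < κ) (hL₁ : 0 < L₁) (hL₂ : 0 < L₂)
    (u : ℝ → (Fin 3 → ℝ) → (Fin 3 → ℝ)) (θ : ℝ → (Fin 3 → ℝ) → ℝ)
    (hu_smooth : ContDiff ℝ (⊤ : ℕ∞) (fun q : ℝ × (Fin 3 → ℝ) => u q.1 q.2))
    (hθ_smooth : ContDiff ℝ (⊤ : ℕ∞) (fun q : ℝ × (Fin 3 → ℝ) => θ q.1 q.2))
    (hθ_bdd : ∃ M, ∀ t x, |θ t x| ≤ M)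
    (hu_per1 : ∀ t x, u t (x + Pi.single 0 L₁) = u t x)
    (hu_per2 : ∀ t x, u t (x + Pi.single 1 L₂) = u t x)
    (hθ_per1 : ∀ t x, θ t (x + Pi.single 0 L₁) = θ t x)
    (hθ_per2 : ∀ t x, θ t (x + Pi.single 1 L₂) = θ t x)
    (hdiv : ∀ t, 0 ≤ t → ∀ x ∈ slab L₁ L₂ d, (∑ i, pd i (fun y => u t y i) x) = 0)
    (hu3_top : ∀ t, 0 ≤ t → ∀ p : ℝ × ℝ, u t ![p.1, p.2, 0] 2 = 0)
    (hu3_bot : ∀ t, 0 ≤ t → ∀ p : ℝ × ℝ, u t ![p.1, p.2, -d] 2 = 0)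
    (hpde : ∀ t, 0 ≤ t → ∀ x ∈ slab L₁ L₂ d,
      deriv (fun s => θ s x) t + (∑ i, u t x i * pd i (θ t) x)
        = κ * ∑ i, pd i (pd i (θ t)) x)
    (hbc_top : ∀ t, 0 ≤ t → ∀ p : ℝ × ℝ, pd 2 (θ t) ![p.1, p.2, 0] = 0)
    (hbc_bot : ∀ t, 0 ≤ t → ∀ p : ℝ × ℝ, pd 2 (θ t) ![p.1, p.2, -d] = 0)
    (θavg μ₀ : ℝ)
    (hθavg : θavg = (L₁ * L₂ * d)⁻¹ * ∫ x in slab L₁ L₂ d, θ 0 x)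
    (hμ₀ : μ₀ = κ * π ^ 2 * min (1 / d ^ 2) (min (4 / L₁ ^ 2) (4 / L₂ ^ 2))) :
    ∀ t, 0 ≤ t →
      Real.sqrt (∫ x in slab L₁ L₂ d, (θ t x - θavg) ^ 2) ≤
        Real.exp (-(μ₀ * t)) * Real.sqrt (∫ x in slab L₁ L₂ d, (θ 0 x - θavg) ^ 2) := by
  have hθt : ∀ t, ContDiff ℝ (⊤ : ℕ∞) (θ t) := fun t =>
    hθ_smooth.comp (contDiff_const.prodMk contDiff_id)
  have hut : ∀ t, ContDiff ℝ (⊤ : ℕ∞) (u t) := fun t =>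
    hu_smooth.comp (contDiff_const.prodMk contDiff_id)
  have hθc := hθ_smooth.continuous
  have hθtc := fun t => (hθt t).continuous
  obtain ⟨θ', hθ'c, hθ'⟩ : ∃ θ' : ℝ → (Fin 3 → ℝ) → ℝ,
      Continuous (fun q : ℝ × (Fin 3 → ℝ) => θ' q.1 q.2) ∧
      ∀ t x, HasDerivAt (fun s => θ s x) (θ' t x) t := by
    refine ⟨fun t x => fderiv ℝ (fun q : ℝ × (Fin 3 → ℝ) => θ q.1 q.2) (t, x) (1, 0),
      (hθ_smooth.continuous_fderiv (by simp)).clm_apply continuous_const, fun t x => ?_⟩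
    exact ((hθ_smooth.differentiable (by simp) (t, x)).hasFDerivAt).comp_hasDerivAt t
      ((hasDerivAt_id t).prodMk (hasDerivAt_const t x))
  have hpde' : ∀ t, 0 ≤ t → ∀ x ∈ slab L₁ L₂ d,
      θ' t x = κ * ∑ i, pd i (pd i (θ t)) x - ∑ i, u t x i * pd i (θ t) x := fun t ht x hx => by
    rw [← hpde t ht x hx, (hθ' t x).deriv]
    ring
  have hsl := slab_subset_Icc L₁ L₂ d
  have hms := measurableSet_slab L₁ L₂ d
  have hM : ∀ t, HasDerivAt (fun t => ∫ x in slab L₁ L₂ d, θ t x)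
      (∫ x in slab L₁ L₂ d, θ' t x) t :=
    hasDerivAt_setIntegral_of_continuous isCompact_Icc hsl hms hθtc hθ'c hθ'
  have hM0 : ∀ t, 0 ≤ t → ∫ x in slab L₁ L₂ d, θ' t x = 0 := fun t ht => by
    rw [setIntegral_congr_fun hms (hpde' t ht)]
    exact setIntegral_advection_diffusion hd.le hL₁.le hL₂.le (hut t) (hθt t) (hu_per1 t)
      (hu_per2 t) (hθ_per1 t) (hθ_per2 t) (hdiv t ht) (fun a b => hu3_top t ht (a, b))
      (fun a b => hu3_bot t ht (a, b)) (fun a b => hbc_top t ht (a, b))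
      (fun a b => hbc_bot t ht (a, b))
  have hMt : ∀ t, 0 ≤ t → ∫ x in slab L₁ L₂ d, θ t x = ∫ x in slab L₁ L₂ d, θ 0 x := fun t ht =>
    constant_of_has_deriv_right_zero (fun s _ => (hM s).continuousAt.continuousWithinAt)
      (fun s hs => by simpa [hM0 s hs.1] using (hM s).hasDerivWithinAt) t (right_mem_Icc.2 ht)
  have hvol : ∫ _ in slab L₁ L₂ d, θavg = L₁ * L₂ * d * θavg := by
    rw [setIntegral_slab hL₁.le hL₂.le hd.le continuous_const]
    simp
    ring
  have hmean : ∀ t, 0 ≤ t → ∫ x in slab L₁ L₂ d, (θ t x - θavg) = 0 := fun t ht => by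
    rw [integral_sub (integrableOn_slab _ _ _ (hθtc t))
      (integrableOn_slab _ _ _ continuous_const), hvol, hMt t ht, hθavg]
    field_simp
    ring
  have hE : ∀ t, HasDerivAt (fun t => ∫ x in slab L₁ L₂ d, (θ t x - θavg) ^ 2)
      (∫ x in slab L₁ L₂ d, 2 * (θ t x - θavg) * θ' t x) t :=
    hasDerivAt_setIntegral_of_continuous isCompact_Icc hsl hms (fun t => by fun_prop)
      (by fun_prop) fun t x => by
        refine (((hθ' t x).sub_const θavg).pow 2).congr_deriv ?_
        simp
  have hE' : ∀ t, 0 ≤ t → ∫ x in slab L₁ L₂ d, 2 * (θ t x - θavg) * θ' t x ≤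
      -(2 * μ₀) * ∫ x in slab L₁ L₂ d, (θ t x - θavg) ^ 2 := fun t ht => by
    have hw : ContDiff ℝ (⊤ : ℕ∞) (fun x => θ t x - θavg) := (hθt t).sub contDiff_const
    have hen := setIntegral_energy (κ := κ) (w := fun x => θ t x - θavg) hd.le hL₁.le hL₂.le
      (hut t) hw (hu_per1 t) (hu_per2 t) (fun x => by rw [hθ_per1]) (fun x => by rw [hθ_per2])
      (hdiv t ht) (fun a b => hu3_top t ht (a, b)) (fun a b => hu3_bot t ht (a, b))
      (fun a b => by rw [pd_sub_const]; exact hbc_top t ht (a, b))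
      (fun a b => by rw [pd_sub_const]; exact hbc_bot t ht (a, b))
    have hpo := poincare_slab (f := fun x => θ t x - θavg) hL₁ hL₂ hd rfl (hw.of_le (by simp))
      (fun x => by rw [hθ_per1]) (fun x => by rw [hθ_per2]) (hmean t ht)
    simp only [pd_sub_const] at hen hpo
    have hc : ∫ x in slab L₁ L₂ d, 2 * (θ t x - θavg) * θ' t x =
        -(2 * κ) * ∫ x in slab L₁ L₂ d, ∑ i, pd i (θ t) x ^ 2 := by
      rw [← hen]
      exact setIntegral_congr_fun hms fun x hx => by rw [hpde' t ht x hx]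
    rw [hc, hμ₀]
    have := mul_le_mul_of_nonneg_left hpo (mul_nonneg zero_le_two hκ.le)
    linarith
  have hanti : AntitoneOn (fun t => exp (2 * μ₀ * t) *
      ∫ x in slab L₁ L₂ d, (θ t x - θavg) ^ 2) (Ici 0) := by
    have hD : ∀ t, HasDerivAt (fun t => exp (2 * μ₀ * t) *
        ∫ x in slab L₁ L₂ d, (θ t x - θavg) ^ 2) _ t := fun t =>
      (((hasDerivAt_id t).const_mul (2 * μ₀)).exp).mul (hE t)
    refine antitoneOn_of_deriv_nonpos (convex_Ici 0)
      (fun t _ => (hD t).continuousAt.continuousWithinAt)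
      (fun t _ => (hD t).differentiableAt.differentiableWithinAt) fun t ht => ?_
    rw [interior_Ici] at ht
    rw [(hD t).deriv]
    have := mul_le_mul_of_nonneg_left (hE' t (le_of_lt ht)) (exp_pos (2 * μ₀ * t)).le
    simp only [id, mul_one]
    linarith
  intro t ht
  have h := hanti (mem_Ici.2 le_rfl) (mem_Ici.2 ht) ht
  simp only [mul_zero, exp_zero, one_mul] at h
  have hexp : exp (-(μ₀ * t)) = √(exp (-(2 * μ₀ * t))) := by
    rw [← exp_half]
    congr 1
    ring
  rw [hexp, ← sqrt_mul (exp_pos _).le]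
  refine sqrt_le_sqrt ?_
  rw [exp_neg, inv_mul_eq_div, le_div_iff₀ (exp_pos _), mul_comm]
  exact h
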